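/- arXiv:2510.12723 — 3 statements merged into one kernel-verified Lean document; each statement's English description precedes it below -/
import Mathlib

section
/- Let n ≥ 1 and let α = (α_1, …, α_l) be a composition of n. The number of permutations π of {1, …, n} having exactly l cycles (counting fixed points as cycles) such that, when the cycles of π are listed as C_1, …, C_l in decreasing order of their minimum elements, the cycle C_i has exactly α_i elements for every 1 ≤ i ≤ l, equals n! / Z_α. -/
open scoped Classical

noncomputable section

namespace PolySym

/-- `Z_α = ∏_{i=1}^{k} (α_1 + ⋯ + α_i)` for a composition `α = (α_1, …, α_k)`. -/
def Zcomp (l : List ℕ) : ℕ :=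
  ((List.range l.length).map fun i => (l.take (i + 1)).sum).prod

/-- The cycle of `x` under `π`. -/
def cyc {n : ℕ} (π : Equiv.Perm (Fin n)) (x : Fin n) : Finset (Fin n) :=
  (Finset.univ : Finset (Fin n)).filter fun y => π.SameCycle x y

theorem mem_cyc {n : ℕ} {π : Equiv.Perm (Fin n)} {x y : Fin n} :
    y ∈ cyc π x ↔ π.SameCycle x y := by simp [cyc]

theorem self_mem_cyc {n : ℕ} (π : Equiv.Perm (Fin n)) (x : Fin n) : x ∈ cyc π x :=
  mem_cyc.2 (Equiv.Perm.SameCycle.refl _ _)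

theorem cyc_closed {n : ℕ} {π : Equiv.Perm (Fin n)} {x y : Fin n} (h : y ∈ cyc π x) :
    π y ∈ cyc π x :=
  mem_cyc.2 (Equiv.Perm.sameCycle_apply_right.2 (mem_cyc.1 h))

theorem cyc_closed_iff {n : ℕ} {π : Equiv.Perm (Fin n)} {x y : Fin n} :
    π y ∈ cyc π x ↔ y ∈ cyc π x := by
  rw [mem_cyc, mem_cyc, Equiv.Perm.sameCycle_apply_right]

theorem cyc_subset {n : ℕ} {π : Equiv.Perm (Fin n)} {x : Fin n} {T : Finset (Fin n)}
    (hx : x ∈ T) (hT : ∀ y ∈ T, π y ∈ T) : cyc π x ⊆ T := by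
  intro y hy
  obtain ⟨i, -, rfl⟩ := (mem_cyc.1 hy).exists_pow_eq'
  clear hy
  induction i with
  | zero => simpa using hx
  | succ i ih =>
    rw [pow_succ', Equiv.Perm.mul_apply]
    exact hT _ ih

/-- The cycles of `π` on `S`, listed by increasing minimum, have sizes given by the list. -/
def Good {n : ℕ} (π : Equiv.Perm (Fin n)) : List ℕ → Finset (Fin n) → Prop
  | [], S => S = ∅
  | k :: L, S => ∃ a ∈ S, (∀ y ∈ S, a ≤ y) ∧ (cyc π a).card = k ∧ Good π L (S \ cyc π a)

theorem cyc_congr {n : ℕ} {π σ : Equiv.Perm (Fin n)} {S : Finset (Fin n)}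
    (hc : ∀ x ∈ S, π x ∈ S) (he : ∀ x ∈ S, π x = σ x) {a : Fin n} (ha : a ∈ S) :
    cyc π a = cyc σ a := by
  apply Finset.Subset.antisymm
  · refine (cyc_subset (T := cyc σ a ∩ S) ?_ ?_).trans Finset.inter_subset_left
    · exact Finset.mem_inter.2 ⟨self_mem_cyc _ _, ha⟩
    · intro y hy
      rw [Finset.mem_inter] at hy ⊢
      refine ⟨?_, hc _ hy.2⟩
      rw [he _ hy.2]
      exact cyc_closed hy.1
  · refine (cyc_subset (T := cyc π a ∩ S) ?_ ?_).trans Finset.inter_subset_left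
    · exact Finset.mem_inter.2 ⟨self_mem_cyc _ _, ha⟩
    · intro y hy
      rw [Finset.mem_inter] at hy ⊢
      rw [← he _ hy.2]
      exact ⟨cyc_closed hy.1, hc _ hy.2⟩

theorem sdiff_closed {n : ℕ} {π : Equiv.Perm (Fin n)} {S : Finset (Fin n)}
    (hc : ∀ x ∈ S, π x ∈ S) (a : Fin n) : ∀ x ∈ S \ cyc π a, π x ∈ S \ cyc π a := by
  intro x hx
  rw [Finset.mem_sdiff] at hx ⊢
  rw [cyc_closed_iff]
  exact ⟨hc _ hx.1, hx.2⟩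

theorem Good_congr {n : ℕ} {π σ : Equiv.Perm (Fin n)} (L : List ℕ) :
    ∀ {S : Finset (Fin n)}, (∀ x ∈ S, π x ∈ S) → (∀ x ∈ S, π x = σ x) →
    (Good π L S ↔ Good σ L S) := by
  induction L with
  | nil => intro S _ _; rfl
  | cons k L ih =>
    intro S hc he
    simp only [Good]
    refine exists_congr fun a => and_congr_right fun ha => and_congr_right fun _ => ?_
    rw [← cyc_congr hc he ha]
    refine and_congr_right fun _ => ih (sdiff_closed hc a) ?_
    intro x hx
    exact he x (Finset.mem_sdiff.1 hx).1

theorem closed_of_fix {n : ℕ} {π : Equiv.Perm (Fin n)} {S : Finset (Fin n)}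
    (hf : ∀ x, x ∉ S → π x = x) : ∀ x ∈ S, π x ∈ S := by
  intro x hx
  by_contra h
  have := π.injective (hf _ h)
  rw [this] at h
  exact h hx

theorem cyc_mul_swap {n : ℕ} {π : Equiv.Perm (Fin n)} {m a : Fin n} (h : π m = a) :
    cyc π m = insert a (cyc (π * Equiv.swap m a) m) := by
  have ha : a ∈ cyc π m := h ▸ cyc_closed (self_mem_cyc π m)
  apply Finset.Subset.antisymm
  · apply cyc_subset
    · exact Finset.mem_insert_of_mem (self_mem_cyc _ _)
    · intro y hy
      by_cases hym : y = m
      · subst hym; rw [h]; exact Finset.mem_insert_self _ _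
      by_cases hya : y = a
      · subst hya
        apply Finset.mem_insert_of_mem
        have := cyc_closed (self_mem_cyc (π * Equiv.swap m y) m)
        simpa using this
      · have hy' := Finset.mem_of_mem_insert_of_ne hy hya
        have := cyc_closed hy'
        rw [Equiv.Perm.mul_apply, Equiv.swap_apply_of_ne_of_ne hym hya] at this
        exact Finset.mem_insert_of_mem this
  · apply Finset.insert_subset ha
    apply cyc_subset (self_mem_cyc _ _)
    intro y hy
    rw [Equiv.Perm.mul_apply]
    apply cyc_closed
    by_cases hym : y = m
    · subst hym; simpa using ha
    by_cases hya : y = a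
    · subst hya; simpa using self_mem_cyc _ _
    · rwa [Equiv.swap_apply_of_ne_of_ne hym hya]

theorem not_mem_cyc_of_fixed {n : ℕ} {σ : Equiv.Perm (Fin n)} {m a : Fin n} (hma : a ≠ m)
    (h : σ a = a) : a ∉ cyc σ m := by
  intro h'
  have h2 : m ∈ cyc σ a := mem_cyc.2 (mem_cyc.1 h').symm
  have := cyc_subset (T := {a}) (π := σ) (x := a) (by simp) (by simp [h]) h2
  exact hma (Finset.mem_singleton.1 this).symm

theorem Good_cons_iff {n : ℕ} {π : Equiv.Perm (Fin n)} {S : Finset (Fin n)} {m : Fin n}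
    (hm : m ∈ S) (hmin : ∀ y ∈ S, m ≤ y) (k : ℕ) (L : List ℕ) :
    Good π (k :: L) S ↔ (cyc π m).card = k ∧ Good π L (S \ cyc π m) := by
  simp only [Good]
  constructor
  · rintro ⟨a, ha, hamin, h⟩
    have : a = m := le_antisymm (hamin _ hm) (hmin _ ha)
    subst this
    exact h
  · intro h
    exact ⟨m, hm, hmin, h⟩

/-- Permutations fixing the complement of `S`, with prescribed cycle data on `S`. -/
def P {n : ℕ} (L : List ℕ) (S : Finset (Fin n)) : Finset (Equiv.Perm (Fin n)) :=
  Finset.univ.filter fun π => (∀ x, x ∉ S → π x = x) ∧ Good π L S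

theorem mem_P {n : ℕ} {L : List ℕ} {S : Finset (Fin n)} {π : Equiv.Perm (Fin n)} :
    π ∈ P L S ↔ (∀ x, x ∉ S → π x = x) ∧ Good π L S := by simp [P]

theorem P_step_iff {n : ℕ} {π : Equiv.Perm (Fin n)} {S : Finset (Fin n)} {m a : Fin n}
    (hm : m ∈ S) (hmin : ∀ y ∈ S, m ≤ y) (ha : a ∈ S) (hma : a ≠ m) (h : π m = a)
    (k : ℕ) (L : List ℕ) :
    π ∈ P ((k + 1) :: L) S ↔ π * Equiv.swap m a ∈ P (k :: L) (S.erase a) := by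
  have hσa : (π * Equiv.swap m a) a = a := by simp [h]
  have hne : ∀ x, x ≠ m → x ≠ a → (π * Equiv.swap m a) x = π x := by
    intro x h1 h2
    rw [Equiv.Perm.mul_apply, Equiv.swap_apply_of_ne_of_ne h1 h2]
  have hcyc := cyc_mul_swap h
  have hnot := not_mem_cyc_of_fixed hma hσa
  rw [mem_P, mem_P]
  have hfix : (∀ x, x ∉ S → π x = x) ↔
      (∀ x, x ∉ S.erase a → (π * Equiv.swap m a) x = x) := by
    constructor
    · intro hf x hx
      by_cases hxa : x = a
      · rw [hxa, hσa]
      · have hxS : x ∉ S := fun hh => hx (Finset.mem_erase.2 ⟨hxa, hh⟩)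
        rw [hne x (fun hh => hxS (hh ▸ hm)) hxa, hf x hxS]
    · intro hf x hx
      rw [← hne x (fun hh => hx (hh ▸ hm)) (fun hh => hx (hh ▸ ha))]
      exact hf x (fun hh => hx (Finset.mem_erase.1 hh).2)
  rw [← hfix]
  refine and_congr_right fun hf => ?_
  have hc := closed_of_fix hf
  rw [Good_cons_iff hm hmin,
    Good_cons_iff (Finset.mem_erase.2 ⟨hma.symm, hm⟩)
      (fun y hy => hmin y (Finset.mem_erase.1 hy).2)]
  have hset : S.erase a \ cyc (π * Equiv.swap m a) m = S \ cyc π m := by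
    rw [hcyc]
    ext x
    simp only [Finset.mem_sdiff, Finset.mem_erase, Finset.mem_insert]
    tauto
  rw [hset]
  refine and_congr ?_ ?_
  · rw [hcyc, Finset.card_insert_of_notMem hnot]
    omega
  · apply Good_congr _ (sdiff_closed hc m)
    intro x hx
    rw [Finset.mem_sdiff] at hx
    refine (hne x ?_ ?_).symm
    · rintro rfl; exact hx.2 (self_mem_cyc _ _)
    · rintro rfl
      apply hx.2
      rw [hcyc]
      exact Finset.mem_insert_self _ _

theorem P_one {n : ℕ} {S : Finset (Fin n)} {m : Fin n}
    (hm : m ∈ S) (hmin : ∀ y ∈ S, m ≤ y) (L : List ℕ) :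
    P (1 :: L) S = P L (S.erase m) := by
  ext π
  rw [mem_P, mem_P, Good_cons_iff hm hmin]
  have key : (cyc π m).card = 1 ↔ π m = m := by
    constructor
    · intro h
      exact Finset.card_le_one.1 h.le _ (cyc_closed (self_mem_cyc π m)) _ (self_mem_cyc π m)
    · intro h
      have h1 := cyc_subset (T := {m}) (π := π) (x := m) (by simp) (by simp [h])
      have h2 : cyc π m = {m} := Finset.Subset.antisymm h1 (by simpa using self_mem_cyc π m)
      rw [h2]; simp
  have hset : π m = m → S \ cyc π m = S.erase m := by
    intro h
    have h1 := cyc_subset (T := {m}) (π := π) (x := m) (by simp) (by simp [h])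
    have h2 : cyc π m = {m} := Finset.Subset.antisymm h1 (by simpa using self_mem_cyc π m)
    rw [h2, Finset.sdiff_singleton_eq_erase]
  rw [key]
  constructor
  · rintro ⟨hf, h1, h2⟩
    rw [hset h1] at h2
    refine ⟨fun x hx => ?_, h2⟩
    by_cases hxm : x = m
    · rw [hxm, h1]
    · exact hf x fun hh => hx (Finset.mem_erase.2 ⟨hxm, hh⟩)
  · rintro ⟨hf, h2⟩
    have h1 := hf m (by simp)
    refine ⟨fun x hx => hf x fun hh => hx (Finset.mem_erase.1 hh).2, h1, ?_⟩
    rwa [hset h1]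

theorem P_succ_card {n : ℕ} {S : Finset (Fin n)} {m : Fin n}
    (hm : m ∈ S) (hmin : ∀ y ∈ S, m ≤ y) {k : ℕ} (hk : 1 ≤ k) (L : List ℕ) :
    (P ((k + 1) :: L) S).card = ∑ a ∈ S.erase m, (P (k :: L) (S.erase a)).card := by
  rw [Finset.card_eq_sum_card_fiberwise (f := fun π => π m) (t := S.erase m)]
  · refine Finset.sum_congr rfl fun a ha => ?_
    obtain ⟨hma, haS⟩ := Finset.mem_erase.1 ha
    refine Finset.card_nbij' (fun π => π * Equiv.swap m a) (fun π => π * Equiv.swap m a) ?_ ?_ ?_ ?_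
    · intro π hπ
      have hπ := Finset.mem_filter.1 hπ
      exact (P_step_iff hm hmin haS hma hπ.2 k L).1 hπ.1
    · intro σ hσ
      have hσ' : σ ∈ P (k :: L) (S.erase a) := hσ
      have hma' : (σ * Equiv.swap m a) m = a := by
        simpa using (mem_P.1 hσ').1 a (by simp)
      refine Finset.mem_filter.2 ⟨(P_step_iff hm hmin haS hma hma' k L).2 ?_, hma'⟩
      simpa [mul_assoc] using hσ'
    · intro π _
      simp [mul_assoc]
    · intro π _
      simp [mul_assoc]
  · intro π hπ
    have hπ' := mem_P.1 hπ
    refine Finset.mem_erase.2 ⟨fun h => ?_, closed_of_fix hπ'.1 m hm⟩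
    have h3 := ((Good_cons_iff hm hmin _ _).1 hπ'.2).1
    have h1 := cyc_subset (T := {m}) (π := π) (x := m) (by simp)
      (by intro y hy; rw [Finset.mem_singleton] at hy ⊢; rw [hy]; exact h)
    have h2 := Finset.card_le_card h1
    rw [h3, Finset.card_singleton] at h2
    omega

/-- The product of suffix sums. -/
def Zrev : List ℕ → ℕ
  | [] => 1
  | k :: L => (k + L.sum) * Zrev L

theorem P_card {n : ℕ} (L : List ℕ) : (∀ k ∈ L, 1 ≤ k) → ∀ S : Finset (Fin n),
    S.card = L.sum → (P L S).card * Zrev L = S.card.factorial := by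
  induction L with
  | nil =>
    intro _ S hS
    have hS : S = ∅ := by simpa using hS
    subst hS
    have : P [] (∅ : Finset (Fin n)) = {1} := by
      ext π
      simp [mem_P, Good, Equiv.ext_iff]
    rw [this]
    simp [Zrev]
  | cons k L ih =>
    intro hpos
    have ih := ih fun k hk => hpos k (List.mem_cons_of_mem _ hk)
    have hk : 1 ≤ k := hpos k (by simp)
    clear hpos
    induction k, hk using Nat.le_induction with
    | base =>
      intro S hS
      rw [List.sum_cons] at hS
      have hne : S.Nonempty := Finset.card_pos.1 (by omega)
      have hm := S.min'_mem hne
      rw [P_one hm (fun y hy => S.min'_le y hy)]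
      have hc := Finset.card_erase_of_mem hm
      have := ih (S.erase (S.min' hne)) (by omega)
      have hcc : (S.erase (S.min' hne)).card = L.sum := by omega
      rw [hcc] at this
      rw [hS, add_comm 1, Nat.factorial_succ, ← this, Zrev]
      ring
    | succ k hk ihk =>
      intro S hS
      rw [List.sum_cons] at hS
      have hne : S.Nonempty := Finset.card_pos.1 (by omega)
      have hm := S.min'_mem hne
      rw [P_succ_card hm (fun y hy => S.min'_le y hy) hk]
      have hc := Finset.card_erase_of_mem hm
      have hN : (S.erase (S.min' hne)).card = k + L.sum := by omega
      have h1 : ∀ a ∈ S.erase (S.min' hne),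
          (P (k :: L) (S.erase a)).card * Zrev (k :: L) = (k + L.sum).factorial := by
        intro a ha
        have hc := Finset.card_erase_of_mem (Finset.mem_erase.1 ha).2
        have hc' : (S.erase a).card = k + L.sum := by omega
        have := ihk (S.erase a) (by rw [List.sum_cons]; omega)
        rwa [hc'] at this
      have h2 := Finset.sum_congr (rfl : S.erase (S.min' hne) = _) h1
      rw [← Finset.sum_mul, Finset.sum_const, hN, smul_eq_mul, Zrev] at h2
      have h3 : (∑ a ∈ S.erase (S.min' hne), (P (k :: L) (S.erase a)).card) * Zrev L
          = (k + L.sum).factorial := by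
        apply Nat.eq_of_mul_eq_mul_left (show 0 < k + L.sum by omega)
        rw [← h2]; ring
      have hS' : S.card = (k + L.sum) + 1 := by omega
      rw [hS', Nat.factorial_succ, ← h3, Zrev]
      ring

theorem Good_iff {n : ℕ} {π : Equiv.Perm (Fin n)} (L : List ℕ) :
    ∀ {S : Finset (Fin n)}, (∀ x ∈ S, π x ∈ S) →
    (Good π L S ↔ ∃ m : Fin L.length → Fin n,
      (∀ i, m i ∈ S) ∧ (∀ i, ∀ y, π.SameCycle (m i) y → m i ≤ y) ∧ StrictMono m ∧
      (∀ x ∈ S, ∃ i, π.SameCycle (m i) x) ∧ (∀ i, (cyc π (m i)).card = L.get i)) := by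
  induction L with
  | nil =>
    intro S _
    constructor
    · intro h
      have h : S = ∅ := h
      subst h
      exact ⟨fun i => i.elim0, fun i => i.elim0, fun i => i.elim0, fun i => i.elim0,
        by simp, fun i => i.elim0⟩
    · rintro ⟨m, -, -, -, h, -⟩
      refine Finset.eq_empty_of_forall_notMem fun x hx => ?_
      obtain ⟨i, -⟩ := h x hx
      exact i.elim0
  | cons k L ih =>
    intro S hc
    constructor
    · rintro ⟨a, ha, hmin, hcard, hg⟩
      obtain ⟨m, h1, h2, h3, h4, h5⟩ := (ih (sdiff_closed hc a)).1 hg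
      have h1' := fun i => Finset.mem_sdiff.1 (h1 i)
      refine ⟨Fin.cons a m, ?_, ?_, ?_, ?_, ?_⟩
      · intro i
        refine Fin.cases ha (fun i => (h1' i).1) i
      · intro i
        refine Fin.cases ?_ (fun i => h2 i) i
        intro y hy
        exact hmin y (cyc_subset ha hc (mem_cyc.2 hy))
      · intro i j
        refine Fin.cases ?_ (fun i => ?_) i <;> refine Fin.cases ?_ (fun j => ?_) j
        · intro h; exact absurd h (lt_irrefl _)
        · intro _
          refine lt_of_le_of_ne (hmin _ (h1' j).1) ?_
          intro hh
          apply (h1' j).2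
          have : a = m j := hh
          rw [← this]
          exact self_mem_cyc _ _
        · intro h; exact absurd h (Fin.not_lt_zero _)
        · intro h
          exact h3 (Fin.succ_lt_succ_iff.1 h)
      · intro x hx
        by_cases hxa : x ∈ cyc π a
        · exact ⟨0, mem_cyc.1 hxa⟩
        · obtain ⟨i, hi⟩ := h4 x (Finset.mem_sdiff.2 ⟨hx, hxa⟩)
          exact ⟨i.succ, hi⟩
      · intro i
        refine Fin.cases hcard (fun i => h5 i) i
    · rintro ⟨m, h1, h2, h3, h4, h5⟩
      refine ⟨m 0, h1 0, ?_, h5 0, ?_⟩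
      · intro y hy
        obtain ⟨i, hi⟩ := h4 y hy
        exact (h3.monotone (Fin.zero_le i)).trans (h2 i y hi)
      · refine (ih (sdiff_closed hc _)).2 ⟨fun i => m i.succ, ?_, fun i => h2 _, ?_, ?_, fun i => h5 i.succ⟩
        · intro i
          refine Finset.mem_sdiff.2 ⟨h1 _, fun h => ?_⟩
          exact absurd (h2 _ _ (mem_cyc.1 h).symm) (not_le.2 (h3 (Fin.succ_pos i)))
        · intro i j hij
          exact h3 (Fin.succ_lt_succ_iff.2 hij)
        · intro x hx
          obtain ⟨hx, hx'⟩ := Finset.mem_sdiff.1 hx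
          obtain ⟨i, hi⟩ := h4 x hx
          revert hi
          refine Fin.cases ?_ (fun i => ?_) i
          · intro h; exact absurd (mem_cyc.2 h) hx'
          · intro h; exact ⟨i, h⟩

theorem Zcomp_eq (L : List ℕ) : Zcomp L = Zrev L.reverse := by
  induction L using List.reverseRecOn with
  | nil => simp [Zcomp, Zrev]
  | append_singleton L k ih =>
    rw [List.reverse_append, List.reverse_singleton, List.singleton_append, Zrev, ← ih, Zcomp, Zcomp]
    rw [List.length_append, List.length_singleton, List.range_succ, List.map_append, List.prod_append]
    have : ∀ i ∈ List.range L.length, ((L ++ [k]).take (i + 1)).sum = (L.take (i + 1)).sum := by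
      intro i hi
      rw [List.mem_range] at hi
      rw [List.take_append_of_le_length (by omega)]
    rw [List.map_congr_left this]
    have h2 : (L ++ [k]).take (L.length + 1) = L ++ [k] := List.take_of_length_le (by simp)
    simp only [List.map_singleton, List.prod_singleton, h2, List.sum_append, List.sum_singleton,
      List.sum_reverse]
    ring

theorem Zrev_pos (L : List ℕ) (h : ∀ k ∈ L, 1 ≤ k) : 0 < Zrev L := by
  induction L with
  | nil => simp [Zrev]
  | cons k L ih =>
    have := h k (by simp)
    exact Nat.mul_pos (by omega) (ih fun k hk => h k (List.mem_cons_of_mem _ hk))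

theorem card_perms_with_cycle_composition (n : ℕ) (hn : 1 ≤ n) (α : Composition n) :
    (((Finset.univ : Finset (Equiv.Perm (Fin n))).filter fun π =>
        ∃ m : Fin α.blocks.length → Fin n,
          (∀ i, ∀ y, π.SameCycle (m i) y → m i ≤ y) ∧
          (∀ i j, i < j → m j < m i) ∧
          (∀ x, ∃ i, π.SameCycle (m i) x) ∧
          (∀ i, ((Finset.univ : Finset (Fin n)).filter fun y =>
            π.SameCycle (m i) y).card = α.blocks.get i)).card : ℚ)
      = (n.factorial : ℚ) / (Zcomp α.blocks : ℚ) := by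
  have hpos : ∀ k ∈ α.blocks.reverse, 1 ≤ k := fun k hk =>
    α.blocks_pos (List.mem_reverse.1 hk)
  have hP := P_card (n := n) α.blocks.reverse hpos Finset.univ (by simp [α.blocks_sum])
  have hZ := Zrev_pos _ hpos
  rw [Zcomp_eq, eq_div_iff (by exact_mod_cast hZ.ne')]
  rw [Finset.card_univ, Fintype.card_fin] at hP
  rw [← hP]
  push_cast
  congr 2
  norm_cast
  congr 1
  ext π
  rw [mem_P, Good_iff _ (by simp)]
  simp only [Finset.mem_filter, Finset.mem_univ, true_and, not_true_eq_false, false_imp_iff,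
    implies_true, true_imp_iff, forall_const]
  have hl : α.blocks.reverse.length = α.blocks.length := List.length_reverse
  constructor
  · rintro ⟨m, h1, h2, h3, h4⟩
    refine ⟨fun i => m (Fin.rev (Fin.cast hl i)), fun i => h1 _, ?_, ?_, ?_⟩
    · intro i j hij
      apply h2
      rw [Fin.rev_lt_rev]
      exact hij
    · intro x
      obtain ⟨i, hi⟩ := h3 x
      refine ⟨Fin.cast hl.symm (Fin.rev i), ?_⟩
      simpa using hi
    · intro i
      refine (h4 _).trans ?_
      simp [List.getElem_reverse, Fin.val_rev]
      congr 1
      omega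
  · rintro ⟨m, h1, h2, h3, h4⟩
    refine ⟨fun i => m (Fin.cast hl.symm (Fin.rev i)), fun i => h1 _, ?_, ?_, ?_⟩
    · intro i j hij
      apply h2
      exact Fin.rev_lt_rev.2 hij
    · intro x
      obtain ⟨i, hi⟩ := h3 x
      refine ⟨Fin.rev (Fin.cast hl i), ?_⟩
      simpa using hi
    · intro i
      refine (h4 _).trans ?_
      simp [List.getElem_reverse, Fin.val_rev]
      congr 1
      omega

end PolySym
end
end

section
/- Define A(n) = Σ_{j ≥ 0 with 2^j ∣ n} p(n / 2^j) for n ≥ 1. Then for every integer m ≥ 1, Σ_{k ∣ m} k · p(k) = Σ_{k ∣ m} (−1)^{m/k − 1} · k · A(k), where both sums range over the positive divisors k of m. -/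
noncomputable section

namespace PolySym

/-- `p n`: the number of partitions of `n`. -/
def partCount (n : ℕ) : ℕ := Fintype.card (Nat.Partition n)

/-- `A n = Σ_{j ≥ 0, 2^j ∣ n} p (n / 2^j)` (for `n ≥ 1`, all such `j` satisfy `j ≤ n`). -/
def A (n : ℕ) : ℕ :=
  ∑ j ∈ Finset.range (n + 1), if 2 ^ j ∣ n then partCount (n / 2 ^ j) else 0

theorem A_odd (k : ℕ) (hk : ¬ 2 ∣ k) : A k = partCount k := by
  unfold A
  rw [Finset.sum_range_succ']
  rw [Finset.sum_eq_zero]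
  · simp
  · intro j _
    rw [if_neg]
    intro h
    exact hk ((Dvd.intro_left (2 ^ j) (pow_succ 2 j).symm).trans h)

theorem A_even (n : ℕ) (hn : 1 ≤ n) : A (2 * n) = partCount (2 * n) + A n := by
  unfold A
  rw [Finset.sum_range_succ']
  have key : ∀ j, (if 2 ^ (j + 1) ∣ 2 * n then partCount (2 * n / 2 ^ (j + 1)) else 0)
      = if 2 ^ j ∣ n then partCount (n / 2 ^ j) else 0 := by
    intro j
    rw [pow_succ, mul_comm (2 ^ j) 2, Nat.mul_div_mul_left _ _ (by norm_num)]
    simp only [Nat.mul_dvd_mul_iff_left (show 0 < 2 by norm_num)]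
  simp only [key, pow_zero, one_dvd, if_true, Nat.div_one]
  rw [add_comm]
  congr 1
  symm
  apply Finset.sum_subset
  · intro j hj
    simp only [Finset.mem_range] at hj ⊢
    omega
  · intro j _ hj
    simp only [Finset.mem_range, not_lt] at hj
    rw [if_neg]
    intro h
    have h1 := Nat.le_of_dvd hn h
    have h2 : j < 2 ^ j := Nat.lt_two_pow_self
    omega

theorem term_eq (k : ℕ) (hk : 1 ≤ k) :
    (k : ℤ) * partCount k = k * A k - if 2 ∣ k then 2 * ((k / 2 : ℕ) : ℤ) * A (k / 2) else 0 := by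
  split_ifs with h
  · obtain ⟨n, rfl⟩ := h
    rw [A_even n (by omega), Nat.mul_div_cancel_left _ (by norm_num)]
    push_cast
    ring
  · rw [A_odd k h, sub_zero]

theorem sign_eq (m k : ℕ) (hm : 1 ≤ m) (hk : k ∣ m) (x : ℤ) :
    (-1 : ℤ) ^ (m / k - 1) * x = x - if 2 * k ∣ m then 2 * x else 0 := by
  obtain ⟨d, rfl⟩ := hk
  have hk0 : 0 < k := Nat.pos_of_mul_pos_right hm
  have hd0 : 0 < d := Nat.pos_of_mul_pos_left hm
  rw [Nat.mul_div_cancel_left _ hk0, mul_comm 2 k]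
  simp only [Nat.mul_dvd_mul_iff_left hk0]
  split_ifs with h
  · have : Odd (d - 1) := by rw [Nat.odd_iff]; omega
    rw [this.neg_one_pow]; ring
  · have : Even (d - 1) := by rw [Nat.even_iff]; omega
    rw [this.neg_one_pow]; ring

theorem sum_divisors_mul_partCount_eq (m : ℕ) (hm : 1 ≤ m) :
    ∑ k ∈ m.divisors, (k : ℤ) * partCount k
      = ∑ k ∈ m.divisors, (-1 : ℤ) ^ (m / k - 1) * k * A k := by
  have hR : ∀ k ∈ m.divisors, (-1 : ℤ) ^ (m / k - 1) * k * A k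
      = k * A k - if 2 * k ∣ m then 2 * ((k : ℤ) * A k) else 0 := by
    intro k hk
    rw [mul_assoc]
    exact sign_eq m k hm (Nat.dvd_of_mem_divisors hk) _
  rw [Finset.sum_congr rfl hR,
    Finset.sum_congr rfl (fun k hk => term_eq k (Nat.pos_of_mem_divisors hk)),
    Finset.sum_sub_distrib, Finset.sum_sub_distrib]
  congr 1
  rw [← Finset.sum_filter, ← Finset.sum_filter]
  refine Finset.sum_bij' (fun k _ => k / 2) (fun k _ => 2 * k) ?_ ?_ ?_ ?_ ?_
  · intro k hk
    simp only [Finset.mem_filter, Nat.mem_divisors] at hk ⊢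
    obtain ⟨⟨h1, h2⟩, n, rfl⟩ := hk
    rw [Nat.mul_div_cancel_left _ (by norm_num)]
    exact ⟨⟨(Dvd.intro_left 2 rfl).trans h1, h2⟩, h1⟩
  · intro k hk
    simp only [Finset.mem_filter, Nat.mem_divisors] at hk ⊢
    exact ⟨⟨hk.2, hk.1.2⟩, Dvd.intro k rfl⟩
  · intro k hk
    exact Nat.mul_div_cancel' (Finset.mem_filter.mp hk).2
  · intro k _
    exact Nat.mul_div_cancel_left _ (by norm_num)
  · intro k _
    ring

end PolySym
end
end

section
/- Let λ be a partition of n ≥ 0. Then Σ_α 1/Z_α = 1/z_λ in ℚ, where the sum is over all compositions α of n whose multiset of parts equals the multiset of parts of λ. -/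
open scoped Classical

noncomputable section

namespace PolySym

/-- `z_λ = ∏_{i ≥ 1} i ^ (m_i λ) * (m_i λ)!` where `m_i λ` is the number of parts of `λ`
equal to `i`. -/
def zPart {n : ℕ} (lam : Nat.Partition n) : ℕ :=
  ∏ i ∈ lam.parts.toFinset, i ^ lam.parts.count i * (lam.parts.count i).factorial

def zM (s : Multiset ℕ) : ℕ :=
  ∏ i ∈ s.toFinset, i ^ s.count i * (s.count i).factorial

def LS (s : Multiset ℕ) : Finset (List ℕ) := s.lists.toFinset

lemma mem_LS {s : Multiset ℕ} {l : List ℕ} : l ∈ LS s ↔ s = (l : Multiset ℕ) := by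
  rw [LS, Multiset.mem_toFinset, Multiset.mem_lists_iff]
  rfl

lemma zM_superset (s : Multiset ℕ) (T : Finset ℕ) (h : s.toFinset ⊆ T) :
    zM s = ∏ i ∈ T, i ^ s.count i * (s.count i).factorial := by
  unfold zM
  apply Finset.prod_subset h
  intro x _ hx
  have : s.count x = 0 := by
    rw [Multiset.count_eq_zero]
    simpa using hx
  simp [this]

lemma zM_cons (a : ℕ) (t : Multiset ℕ) :
    zM (a ::ₘ t) = a * (t.count a + 1) * zM t := by
  rw [zM_superset (a ::ₘ t) (insert a t.toFinset) (by simp),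
    zM_superset t (insert a t.toFinset) (by simp),
    ← Finset.mul_prod_erase _ _ (Finset.mem_insert_self a t.toFinset),
    ← Finset.mul_prod_erase _ (fun i => i ^ t.count i * (t.count i).factorial)
      (Finset.mem_insert_self a t.toFinset)]
  have : ∏ i ∈ (insert a t.toFinset).erase a,
      i ^ (a ::ₘ t).count i * ((a ::ₘ t).count i).factorial
      = ∏ i ∈ (insert a t.toFinset).erase a, i ^ t.count i * (t.count i).factorial := by
    apply Finset.prod_congr rfl
    intro i hi
    rw [Multiset.count_cons_of_ne (Finset.ne_of_mem_erase hi)]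
  rw [this, Multiset.count_cons_self, Nat.factorial_succ, pow_succ]
  ring

lemma Zcomp_append (l : List ℕ) (a : ℕ) : Zcomp (l ++ [a]) = Zcomp l * (l.sum + a) := by
  unfold Zcomp
  rw [List.length_append, List.length_singleton, List.range_succ, List.map_append,
    List.prod_append]
  congr 1
  · congr 1
    apply List.map_congr_left
    intro i hi
    rw [List.take_append_of_le_length]
    have := List.mem_range.1 hi
    omega
  · simp

lemma sum_lists_step (s : Multiset ℕ) (hs : s ≠ 0) (f : List ℕ → ℚ) :
    ∑ l ∈ LS s, f l = ∑ a ∈ s.toFinset, ∑ l ∈ LS (s.erase a), f (l ++ [a]) := by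
  rw [Finset.sum_sigma']
  symm
  apply Finset.sum_bij (fun p _ => p.2 ++ [p.1])
  · rintro ⟨a, l⟩ h
    simp only [Finset.mem_sigma, Multiset.mem_toFinset, mem_LS] at h ⊢
    rw [← Multiset.coe_add, ← h.2, Multiset.coe_singleton, add_comm, Multiset.singleton_add,
      Multiset.cons_erase h.1]
  · rintro ⟨a, l⟩ _ ⟨b, m⟩ _ h
    have := List.append_inj' h rfl
    simp at this
    simp [this]
  · intro l hl
    rw [mem_LS] at hl
    subst hl
    rcases List.eq_nil_or_concat l with rfl | ⟨m, a, rfl⟩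
    · simp at hs
    · have e : ((m ++ [a] : List ℕ) : Multiset ℕ) = a ::ₘ (m : Multiset ℕ) := by
        rw [← Multiset.coe_add, Multiset.coe_singleton, add_comm, Multiset.singleton_add]
      refine ⟨⟨a, m⟩, ?_, by simp⟩
      rw [Finset.mem_sigma, mem_LS]
      simp only [List.concat_eq_append, e, Multiset.erase_cons_head]
      simp
  · intros; rfl

lemma main_lists (k : ℕ) : ∀ s : Multiset ℕ, s.card = k → (∀ i ∈ s, 0 < i) →
    ∑ l ∈ LS s, (1 : ℚ) / (Zcomp l : ℚ) = 1 / (zM s : ℚ) := by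
  induction k with
  | zero =>
    intro s hs _
    rw [Multiset.card_eq_zero] at hs
    subst hs
    have : LS (0 : Multiset ℕ) = {[]} := by
      ext l
      rw [mem_LS]
      simp [eq_comm]
    rw [this]
    simp [Zcomp, zM]
  | succ k ih =>
    intro s hs hpos
    have hs0 : s ≠ 0 := by rintro rfl; simp at hs
    have hsum : (s.sum : ℚ) ≠ 0 := by
      obtain ⟨a, ha⟩ := Multiset.exists_mem_of_ne_zero hs0
      have := Multiset.le_sum_of_mem ha
      have := hpos a ha
      exact_mod_cast (by omega : s.sum ≠ 0)
    rw [sum_lists_step s hs0]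
    have key : ∀ a ∈ s.toFinset, ∑ l ∈ LS (s.erase a), (1 : ℚ) / (Zcomp (l ++ [a]) : ℚ)
        = ((s.count a * a : ℕ) : ℚ) * (1 / (s.sum * zM s : ℚ)) := by
      intro a ha
      rw [Multiset.mem_toFinset] at ha
      obtain ⟨t, rfl⟩ := Multiset.exists_cons_of_mem ha
      rw [Multiset.erase_cons_head]
      have h1 := ih t (by simpa using hs) (fun i hi => hpos i (Multiset.mem_cons_of_mem hi))
      have h2 : ∀ l ∈ LS t, (1 : ℚ) / (Zcomp (l ++ [a]) : ℚ)
          = (1 / (Zcomp l : ℚ)) * (1 / ((a ::ₘ t).sum : ℚ)) := by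
        intro l hl
        rw [mem_LS] at hl
        subst hl
        rw [Zcomp_append, Multiset.sum_cons, Multiset.sum_coe, add_comm a]
        push_cast
        rw [div_mul_div_comm, one_mul]
      rw [Finset.sum_congr rfl h2, ← Finset.sum_mul, h1, zM_cons, Multiset.count_cons_self]
      have ha0 : (a : ℚ) ≠ 0 := by exact_mod_cast (hpos a ha).ne'
      have hc : ((t.count a : ℚ) + 1) ≠ 0 := by positivity
      generalize (a ::ₘ t).sum = S at hsum ⊢
      push_cast
      rw [div_mul_div_comm, one_mul, mul_one_div,
        show ((S : ℚ) * (a * (t.count a + 1) * zM t))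
          = ((t.count a + 1) * a) * (zM t * S) by ring,
        ← div_div (((t.count a : ℚ) + 1) * a), div_self (mul_ne_zero hc ha0)]
    rw [Finset.sum_congr rfl key, ← Finset.sum_mul, ← Nat.cast_sum]
    have : ∑ a ∈ s.toFinset, s.count a * a = s.sum := by
      rw [Finset.sum_multiset_count s]
      simp
    rw [this, mul_one_div, ← div_div, div_self hsum]

theorem sum_inv_Zcomp_eq_inv_zPart (n : ℕ) (lam : Nat.Partition n) :
    ∑ c ∈ (Finset.univ : Finset (Composition n)).filter
        (fun c => (c.blocks : Multiset ℕ) = lam.parts),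
      (1 : ℚ) / (Zcomp c.blocks : ℚ)
    = 1 / (zPart lam : ℚ) := by
  have h := main_lists _ lam.parts rfl (fun i hi => lam.parts_pos hi)
  change _ = 1 / (zM lam.parts : ℚ)
  rw [← h]
  apply Finset.sum_bij (fun c _ => c.blocks)
  · intro c hc
    rw [mem_LS]
    exact (Finset.mem_filter.1 hc).2.symm
  · intro c _ d _ e
    exact Composition.ext e
  · intro l hl
    rw [mem_LS] at hl
    have hl' : lam.parts = (l : Multiset ℕ) := hl
    refine ⟨⟨l, ?_, ?_⟩, ?_, rfl⟩
    · intro i hi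
      apply lam.parts_pos
      rw [hl']
      exact hi
    · rw [← lam.parts_sum, hl', Multiset.sum_coe]
    · simp [hl']
  · intros; rfl

end PolySym
end
end
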